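/- arXiv:1610.02202 — 2 statements merged into one kernel-verified Lean document; each statement's English description precedes it below -/
import Mathlib

section
/- Let U ⊂ ℝ^{n+1} be open, p ∈ U, I an open interval containing 0. Let ν : U × I → ℝ^{n+1} and H : U × I → ℝ be C¹ with η(ν,ν) ≡ −1, and let μ : U → ℝ^{n+1}, β : U → ℝ be C¹ with η(μ,μ) ≡ 1 and η(μ,e) ≡ 0 on U and D_e μ(p) = 0. Write α = η(ν,μ)(p,0), v = −η(ν,e)(p,0), assume v > 0, and set μ⊤ = μ(p) + αν(p,0), ν^Σ = ν(p,0) − αμ(p), e^τ = e − (v/(1+α²))ν^Σ. Let c : I → U be the C¹ curve with c(0) = p and c'(t) = (H/v)(c(t),t)·e. Assume: (i) η(ν(c(t),t), μ(c(t))) = β(c(t)) for all t ∈ I; (ii) (d/dt)|_{t=0} ν(c(t),t) = G + (H/v)(p,0)·D_{e−vν} ν(p,0), where G ∈ ℝ^{n+1} satisfies η(G, ν(p,0)) = 0 and η(G, X) = D_X H(p,0) (spatial derivative) for every X with η(X, ν(p,0)) = 0; (iii) D_{e^τ}(η(ν(·,0),μ(·)))(p) = D_{e^τ} β(p). Then η(G,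 μ⊤) = (H/(1+α²))·[ α·A(μ⊤,μ⊤) − A^Σ(ν^Σ,ν^Σ) + D_{ν^Σ} β(p) ], where A(X,Y) := η(D_X ν(p,0), Y) and A^Σ(X,Y) := η(D_X μ(p), Y). (This is the boundary derivative identity ∇_{μ⊤} H = (H/(1+α²))[α A(μ⊤,μ⊤) − A^Σ(ν^Σ,ν^Σ) + ∇^Σ_{ν^Σ} α] for mean curvature flow with prescribed contact angle on a vertical cylinder.) -/
noncomputable section

/-- The Minkowski inner product `η` on `ℝ^{n+1}`:
`η(x,y) = ∑_{i=1}^n xᵢyᵢ - x_{n+1}y_{n+1}`. -/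
def eta {n : ℕ} (x y : Fin (n + 1) → ℝ) : ℝ :=
  (∑ i : Fin n, x i.castSucc * y i.castSucc) - x (Fin.last n) * y (Fin.last n)

/-- The timelike coordinate vector `e := e_{n+1}`, with `η(e,e) = -1`. -/
def eVec (n : ℕ) : Fin (n + 1) → ℝ := Pi.single (Fin.last n) 1

lemma eta_comm {n : ℕ} (x y : Fin (n + 1) → ℝ) : eta x y = eta y x := by
  simp [eta, mul_comm]

lemma eta_add_left {n : ℕ} (x y z : Fin (n + 1) → ℝ) :
    eta (x + y) z = eta x z + eta y z := by
  simp only [eta, Pi.add_apply, add_mul, Finset.sum_add_distrib]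
  ring

lemma eta_smul_left {n : ℕ} (r : ℝ) (x y : Fin (n + 1) → ℝ) :
    eta (r • x) y = r * eta x y := by
  simp only [eta, Pi.smul_apply, smul_eq_mul, mul_assoc, mul_sub, Finset.mul_sum]

lemma eta_add_right {n : ℕ} (x y z : Fin (n + 1) → ℝ) :
    eta x (y + z) = eta x y + eta x z := by
  rw [eta_comm, eta_add_left, eta_comm y, eta_comm z]

lemma eta_smul_right {n : ℕ} (r : ℝ) (x y : Fin (n + 1) → ℝ) :
    eta x (r • y) = r * eta x y := by
  rw [eta_comm, eta_smul_left, eta_comm]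

lemma eta_sub_left {n : ℕ} (x y z : Fin (n + 1) → ℝ) :
    eta (x - y) z = eta x z - eta y z := by
  have h := eta_add_left (x - y) y z
  rw [sub_add_cancel] at h
  linarith

lemma eta_sub_right {n : ℕ} (x y z : Fin (n + 1) → ℝ) :
    eta x (y - z) = eta x y - eta x z := by
  rw [eta_comm, eta_sub_left, eta_comm y, eta_comm z]

/-- The Minkowski inner product as a continuous bilinear map. -/
def etaCLM (n : ℕ) : (Fin (n + 1) → ℝ) →L[ℝ] (Fin (n + 1) → ℝ) →L[ℝ] ℝ :=
  LinearMap.toContinuousBilinearMap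
    (LinearMap.mk₂ ℝ eta eta_add_left eta_smul_left eta_add_right eta_smul_right)

lemma HasDerivAt.eta {n : ℕ} {f g : ℝ → Fin (n + 1) → ℝ} {f' g' : Fin (n + 1) → ℝ} {t : ℝ}
    (hf : HasDerivAt f f' t) (hg : HasDerivAt g g' t) :
    HasDerivAt (fun s => eta (f s) (g s)) (eta (f t) g' + eta f' (g t)) t :=
  (etaCLM n).hasDerivAt_of_bilinear (fun _ => hf) (fun _ => hg)

lemma fderiv_eta_apply {n : ℕ} {E : Type*} [NormedAddCommGroup E] [NormedSpace ℝ E]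
    {f g : E → Fin (n + 1) → ℝ} {x : E}
    (hf : DifferentiableAt ℝ f x) (hg : DifferentiableAt ℝ g x) (X : E) :
    fderiv ℝ (fun y => eta (f y) (g y)) x X =
      eta (f x) (fderiv ℝ g x X) + eta (fderiv ℝ f x X) (g x) := by
  have h := ((etaCLM n).hasFDerivAt_of_bilinear hf.hasFDerivAt hg.hasFDerivAt).fderiv
  exact DFunLike.congr_fun h X

/-- If `η(f, f)` is locally constant, then the derivative of `f` is `η`-orthogonal to `f`. -/
lemma eta_fderiv_self_eq_zero {n : ℕ} {E : Type*} [NormedAddCommGroup E] [NormedSpace ℝ E]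
    {f : E → Fin (n + 1) → ℝ} {x : E} {U : Set E} (hU : U ∈ nhds x) {k : ℝ}
    (hk : ∀ y ∈ U, eta (f y) (f y) = k) (hf : DifferentiableAt ℝ f x) (X : E) :
    eta (fderiv ℝ f x X) (f x) = 0 := by
  have h := fderiv_eta_apply hf hf X
  have h' : (fun y => eta (f y) (f y)) =ᶠ[nhds x] fun _ => k :=
    Filter.mem_of_superset hU hk
  rw [h'.fderiv_eq, eta_comm (f x)] at h
  simp at h
  linarith

/-- **Lemma `bdryH`** (boundary derivative identity
`∇_{μ⊤} H = (H/(1+α²))[α A(μ⊤,μ⊤) - A^Σ(ν^Σ,ν^Σ) + ∇^Σ_{ν^Σ} α]` for mean curvature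
flow with prescribed contact angle `β` on a vertical cylinder): `ν(·,t)` extends the
unit timelike normal, `H` the mean curvature, `μ` the cylinder normal (with
`D_e μ(p) = 0`), and `c` the curve of boundary points moving vertically with speed
`H/v`.  Hypothesis (i) is the prescribed angle condition along `c`, (ii) is
`∂ν/∂t = ∇H` (with `G` the tangential spatial gradient of `H`), and (iii) says the
angle function agrees with `β` to first order in the direction `e^τ`. -/
theorem boundary_derivative_of_H
    {n : ℕ} (U : Set (Fin (n + 1) → ℝ)) (hU : IsOpen U)
    (p : Fin (n + 1) → ℝ) (hp : p ∈ U)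
    (a b : ℝ) (ha : a < 0) (hb : 0 < b)  -- I = (a,b) is an open interval around 0
    (ν : (Fin (n + 1) → ℝ) → ℝ → Fin (n + 1) → ℝ)
    (H : (Fin (n + 1) → ℝ) → ℝ → ℝ)
    (hνC : ContDiffOn ℝ 1 (fun q : (Fin (n + 1) → ℝ) × ℝ => ν q.1 q.2) (U ×ˢ Set.Ioo a b))
    (hHC : ContDiffOn ℝ 1 (fun q : (Fin (n + 1) → ℝ) × ℝ => H q.1 q.2) (U ×ˢ Set.Ioo a b))
    (μ : (Fin (n + 1) → ℝ) → Fin (n + 1) → ℝ) (β : (Fin (n + 1) → ℝ) → ℝ)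
    (hμC : ContDiffOn ℝ 1 μ U) (hβC : ContDiffOn ℝ 1 β U)
    (hνunit : ∀ x ∈ U, ∀ t ∈ Set.Ioo a b, eta (ν x t) (ν x t) = -1)
    (hμunit : ∀ x ∈ U, eta (μ x) (μ x) = 1)
    (hμe : ∀ x ∈ U, eta (μ x) (eVec n) = 0)
    (hdeμ : fderiv ℝ μ p (eVec n) = 0)
    (α v : ℝ) (hα : α = eta (ν p 0) (μ p)) (hv : v = -eta (ν p 0) (eVec n))
    (hvpos : 0 < v)
    (μtop νSig eτ : Fin (n + 1) → ℝ)
    (hμtop : μtop = μ p + α • ν p 0) (hνSig : νSig = ν p 0 - α • μ p)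
    (heτ : eτ = eVec n - (v / (1 + α ^ 2)) • νSig)
    -- the boundary curve, moving vertically with speed `H/v`
    (c : ℝ → Fin (n + 1) → ℝ) (hc0 : c 0 = p)
    (hcU : ∀ t ∈ Set.Ioo a b, c t ∈ U)
    (hcd : ∀ t ∈ Set.Ioo a b,
      HasDerivAt c ((H (c t) t / (-eta (ν (c t) t) (eVec n))) • eVec n) t)
    -- (i): the prescribed angle condition holds along `c`
    (hangle : ∀ t ∈ Set.Ioo a b, eta (ν (c t) t) (μ (c t)) = β (c t))
    -- (ii): `∂ν/∂t = ∇H`; `G` is the tangential spatial gradient of `H` at `(p,0)`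
    (G : Fin (n + 1) → ℝ)
    (hGtan : eta G (ν p 0) = 0)
    (hGgrad : ∀ X : Fin (n + 1) → ℝ, eta X (ν p 0) = 0 →
      eta G X = fderiv ℝ (fun x => H x 0) p X)
    (hνevol : HasDerivAt (fun t => ν (c t) t)
      (G + (H p 0 / v) • fderiv ℝ (fun x => ν x 0) p (eVec n - v • ν p 0)) 0)
    -- (iii): the angle function agrees with `β` to first order in direction `e^τ`
    (hfirstorder : fderiv ℝ (fun x => eta (ν x 0) (μ x)) p eτ = fderiv ℝ β p eτ) :
    eta G μtop =
      (H p 0 / (1 + α ^ 2)) *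
        (α * eta (fderiv ℝ (fun x => ν x 0) p μtop) μtop -
          eta (fderiv ℝ μ p νSig) νSig + fderiv ℝ β p νSig) := by
  have hUp : U ∈ nhds p := hU.mem_nhds hp
  have h0 : (0 : ℝ) ∈ Set.Ioo a b := ⟨ha, hb⟩
  have hν : DifferentiableAt ℝ (fun x => ν x 0) p := by
    have h : DifferentiableAt ℝ (fun q : (Fin (n + 1) → ℝ) × ℝ => ν q.1 q.2) (p, 0) :=
      (hνC.contDiffAt (prod_mem_nhds hUp (Ioo_mem_nhds ha hb))).differentiableAt one_ne_zero
    exact h.comp (f := fun x : Fin (n + 1) → ℝ => (x, (0 : ℝ))) p (by fun_prop)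
  have hμ : DifferentiableAt ℝ μ p := (hμC.contDiffAt hUp).differentiableAt one_ne_zero
  have hβ : DifferentiableAt ℝ β p := (hβC.contDiffAt hUp).differentiableAt one_ne_zero
  have hνorth := eta_fderiv_self_eq_zero hUp (fun y hy => hνunit y hy 0 h0) hν
  have hμorth := eta_fderiv_self_eq_zero hUp hμunit hμ
  have hc : HasDerivAt c ((H p 0 / v) • eVec n) 0 := by
    simpa only [hc0, ← hv] using hcd 0 h0
  have hμc : HasDerivAt (fun t => μ (c t)) 0 0 := by
    have h := HasFDerivAt.comp_hasDerivAt_of_eq 0 hμ.hasFDerivAt hc hc0.symm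
    rwa [map_smul, hdeμ, smul_zero] at h
  have hβc : HasDerivAt (fun t => β (c t)) ((H p 0 / v) * fderiv ℝ β p (eVec n)) 0 := by
    have h := HasFDerivAt.comp_hasDerivAt_of_eq 0 hβ.hasFDerivAt hc hc0.symm
    rwa [map_smul, smul_eq_mul] at h
  have hi := (hβc.congr_of_eventuallyEq
    (Filter.mem_of_superset (Ioo_mem_nhds ha hb) hangle)).unique (hνevol.eta hμc)
  rw [fderiv_eta_apply hν hμ] at hfirstorder
  have h_denom : 1 + α ^ 2 ≠ 0 := by positivity
  have hv_ne := hvpos.ne'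
  subst hμtop hνSig heτ
  simp only [hc0, map_add, map_sub, map_smul, hdeμ, eta_add_left, eta_add_right, eta_sub_left,
    eta_sub_right, eta_smul_left, eta_smul_right, smul_eq_mul, hνorth, hμorth, hGtan,
    eta_comm (ν p 0) (fderiv ℝ μ p _)] at hi hfirstorder ⊢
  have hz : eta (ν p 0) 0 = 0 := by simp [eta]
  rw [hz] at hi hfirstorder
  linear_combination (norm := skip) -hi - (H p 0 / v) * hfirstorder
  field_simp
  ring
end
end

section
/- Let U ⊂ ℝ³ be open, p ∈ U, and let ν, μ : U → ℝ³ be C¹ vector fields with η(ν,ν) ≡ −1, η(μ,μ) ≡ 1, η(μ,e) ≡ 0 on U (e = e₃). Set α := η(ν,μ), v := −η(ν,e), and at p set μ⊤ := μ + αν, ν^Σ := ν − αμ, e^τ := e − (v/(1+α²))ν^Σ, T := √(1+α²)·(v²−1−α²)^{−1/2}·e^τ. Assume at p: (i) Dμ(p)X = κ·(X − η(X,μ)μ + η(X,e)e) for all X, with κ > 0; (ii) Dν(p) is η-self-adjoint on ν(p)^⊥; (iii) D_{e^τ} v(p) = 0; (iv) D_e α(p) = 0 and |D_V α(p)| ≤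 C_α for the unit horizontal tangent V (η(V,V)=1, η(V,e)=η(V,μ)=0); (v) the mean curvature H := A(T,T) + A(μ⊤,μ⊤)/(1+α²) satisfies |H| ≤ C_H·v, where A(X,Y) := η(D_X ν, Y); (vi) v > 2√(1+α²). Then D_{μ⊤} v(p) ≤ (v²/(1+α²))·[ (1+α²)(|α|·C_H + (2α²+1)·C_α + κ) − v·κ ]. In particular, if moreover v ≥ κ⁻¹·(1+α²)·(|α|·C_H + (2α²+1)·C_α + κ), then D_{μ⊤} v(p) ≤ 0. -/
noncomputable section

/-- The Minkowski inner product on `ℝ³`: `η(x,y) = x₁y₁ + x₂y₂ - x₃y₃`. -/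
def eta3 (x y : Fin 3 → ℝ) : ℝ := x 0 * y 0 + x 1 * y 1 - x 2 * y 2

/-- The timelike coordinate vector `e := e₃`, with `η(e,e) = -1`. -/
def e3 : Fin 3 → ℝ := ![0, 0, 1]

lemma eta3_add_left (x y z : Fin 3 → ℝ) : eta3 (x + y) z = eta3 x z + eta3 y z := by
  simp only [eta3, Pi.add_apply]; ring

lemma eta3_add_right (x y z : Fin 3 → ℝ) : eta3 x (y + z) = eta3 x y + eta3 x z := by
  simp only [eta3, Pi.add_apply]; ring

lemma eta3_smul_left (c : ℝ) (x y : Fin 3 → ℝ) : eta3 (c • x) y = c * eta3 x y := by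
  simp only [eta3, Pi.smul_apply, smul_eq_mul]; ring

lemma eta3_smul_right (c : ℝ) (x y : Fin 3 → ℝ) : eta3 x (c • y) = c * eta3 x y := by
  simp only [eta3, Pi.smul_apply, smul_eq_mul]; ring

lemma eta3_comm (x y : Fin 3 → ℝ) : eta3 x y = eta3 y x := by
  simp only [eta3]; ring

lemma fderiv_eta3 {f g : (Fin 3 → ℝ) → Fin 3 → ℝ} {p : Fin 3 → ℝ}
    (hf : DifferentiableAt ℝ f p) (hg : DifferentiableAt ℝ g p) (X : Fin 3 → ℝ) :
    fderiv ℝ (fun x => eta3 (f x) (g x)) p X =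
      eta3 (fderiv ℝ f p X) (g p) + eta3 (f p) (fderiv ℝ g p X) := by
  have hf' := hasFDerivAt_pi'.1 hf.hasFDerivAt
  have hg' := hasFDerivAt_pi'.1 hg.hasFDerivAt
  have h := (((hf' 0).mul (hg' 0)).add ((hf' 1).mul (hg' 1))).sub ((hf' 2).mul (hg' 2))
  have h' : HasFDerivAt (fun x => eta3 (f x) (g x)) _ p := h
  rw [h'.fderiv]
  simp [eta3]
  ring

/-- The derivative of the gradient function in the direction `μ⊤`, solved from the linear relations
between the components `x`, `y`, `z` of `D_{μ⊤} ν` along `μ`, `V`, `e`. -/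
lemma conormal_derivative_eq {α β v m H x y z : ℝ} (hβ : β ≠ 0)
    (hnorm : β ^ 2 = v ^ 2 - 1 - α ^ 2)
    (htangent : α * x + β * y + v * z = 0) (hsymm : β * z + v * y = v * m)
    (hmean : H * (1 + α ^ 2) = x - α * v ^ 2 * m / β) :
    -z = v * (α * H + m / β * (v ^ 2 - 1)) := by
  have hα : 1 + α ^ 2 ≠ 0 := by positivity
  field_simp at hmean ⊢
  apply mul_left_cancel₀ hα
  linear_combination -β * v * htangent + β ^ 2 * hsymm - v * α * hmean
    + (v * m - β * z) * hnorm

/-- The scalar inequality behind the boundary estimate. -/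
lemma conormal_derivative_le {α β v κ δ H CH Cα : ℝ} (hκ : 0 < κ) (hβ : β ≠ 0)
    (hnorm : β ^ 2 = v ^ 2 - 1 - α ^ 2) (hv : 0 < v) (hbig : 4 * (1 + α ^ 2) < v ^ 2)
    (hδ : |δ| ≤ Cα) (hH : |H| ≤ CH * v) :
    v * (α * H + (δ - κ * β) / β * (v ^ 2 - 1)) ≤
      (v ^ 2 / (1 + α ^ 2)) *
        ((1 + α ^ 2) * (|α| * CH + (2 * α ^ 2 + 1) * Cα + κ) - v * κ) := by
  have hα : 0 < 1 + α ^ 2 := by positivity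
  have hβ' : 0 < |β| := abs_pos.2 hβ
  have hCα : 0 ≤ Cα := (abs_nonneg δ).trans hδ
  have hα2 := sq_nonneg α
  have h1v : 1 < v := by nlinarith
  have hmean : α * H ≤ |α| * (CH * v) :=
    (le_abs_self _).trans (by rw [abs_mul]; gcongr)
  have hroot : v ^ 2 - 1 ≤ (2 * α ^ 2 + 1) * v * |β| := by
    apply abs_le_of_sq_le_sq' _ (by positivity) |>.2
    rw [mul_pow, sq_abs, hnorm]
    have h1 : 0 ≤ v ^ 2 * (4 * α ^ 2 * (v ^ 2 - 1 - α ^ 2) - α ^ 2) := by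
      have : 0 ≤ α ^ 2 * (4 * (v ^ 2 - 1 - α ^ 2) - 1) := by
        apply mul_nonneg hα2; linarith
      apply mul_nonneg (sq_nonneg v); linarith
    have h2 : 0 ≤ v ^ 2 * (4 * α ^ 4 * (v ^ 2 - 1 - α ^ 2)) := by
      have : 0 ≤ v ^ 2 - 1 - α ^ 2 := by linarith
      positivity
    nlinarith
  have hangle : δ / β * (v ^ 2 - 1) ≤ (2 * α ^ 2 + 1) * Cα * v := by
    calc δ / β * (v ^ 2 - 1) ≤ Cα / |β| * (v ^ 2 - 1) := by
          have : 0 ≤ v ^ 2 - 1 := by nlinarith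
          refine mul_le_mul_of_nonneg_right ?_ this
          calc δ / β ≤ |δ / β| := le_abs_self _
            _ ≤ Cα / |β| := by rw [abs_div]; gcongr
      _ ≤ Cα / |β| * ((2 * α ^ 2 + 1) * v * |β|) := by gcongr
      _ = (2 * α ^ 2 + 1) * Cα * v := by field_simp
  have hcurv : -(v ^ 2 - 1) ≤ v - v ^ 2 / (1 + α ^ 2) := by
    have : v ^ 2 / (1 + α ^ 2) ≤ v ^ 2 := div_le_self (sq_nonneg v) (by linarith)
    linarith
  have hsplit : (δ - κ * β) / β = δ / β - κ := by field_simp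
  have hrhs : (v ^ 2 / (1 + α ^ 2)) *
        ((1 + α ^ 2) * (|α| * CH + (2 * α ^ 2 + 1) * Cα + κ) - v * κ) =
      v * (|α| * (CH * v) + (2 * α ^ 2 + 1) * Cα * v + κ * (v - v ^ 2 / (1 + α ^ 2))) := by
    field_simp
    ring
  rw [hsplit, hrhs]
  have := mul_le_mul_of_nonneg_left hcurv hκ.le
  refine mul_le_mul_of_nonneg_left ?_ hv.le
  linarith

/-- **Key boundary gradient estimate in dimension `n = 2`** (main computation of
Proposition `Gradest`): at a sufficiently large boundary critical point of the
gradient function `v = -η(ν,e)` on the cylinder over a strictly convex curve of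
curvature `κ > 0`, with graphical boundary angle (tangential derivative bound `C_α`)
and mean curvature bound `|H| ≤ C_H v`, one has
`D_{μ⊤} v ≤ (v²/(1+α²))[(1+α²)(|α|C_H + (2α²+1)C_α + κ) - vκ]`;
in particular `D_{μ⊤} v ≤ 0` once `v ≥ κ⁻¹(1+α²)(|α|C_H + (2α²+1)C_α + κ)`. -/
theorem boundary_gradient_estimate
    (U : Set (Fin 3 → ℝ)) (hU : IsOpen U)
    (ν μ : (Fin 3 → ℝ) → Fin 3 → ℝ)
    (hν : ContDiffOn ℝ 1 ν U) (hμ : ContDiffOn ℝ 1 μ U)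
    (hνunit : ∀ x ∈ U, eta3 (ν x) (ν x) = -1)
    (hμunit : ∀ x ∈ U, eta3 (μ x) (μ x) = 1)
    (hμe : ∀ x ∈ U, eta3 (μ x) e3 = 0)
    (p : Fin 3 → ℝ) (hp : p ∈ U)
    (α v : ℝ) (hα : α = eta3 (ν p) (μ p)) (hv : v = -eta3 (ν p) e3)
    (μtop νSig eτ T : Fin 3 → ℝ)
    (hμtop : μtop = μ p + α • ν p)
    (hνSig : νSig = ν p - α • μ p)
    (heτ : eτ = e3 - (v / (1 + α ^ 2)) • νSig)
    (hT : T = (Real.sqrt (1 + α ^ 2) / Real.sqrt (v ^ 2 - 1 - α ^ 2)) • eτ)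
    -- (i): cylinder over a strictly convex curve of curvature `κ > 0`
    (κ : ℝ) (hκ : 0 < κ)
    (hDμ : ∀ X : Fin 3 → ℝ,
      fderiv ℝ μ p X = κ • (X - eta3 X (μ p) • μ p + eta3 X e3 • e3))
    -- (ii): `Dν(p)` is `η`-self-adjoint on `ν(p)^⊥`
    (hsymν : ∀ X Y : Fin 3 → ℝ, eta3 X (ν p) = 0 → eta3 Y (ν p) = 0 →
      eta3 (fderiv ℝ ν p X) Y = eta3 (fderiv ℝ ν p Y) X)
    -- (iii): critical point of the gradient function in the direction `e^τ`
    (hcrit : fderiv ℝ (fun x => -eta3 (ν x) e3) p eτ = 0)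
    -- (iv): the boundary angle is graphical with tangential derivative bound `C_α`
    (Cα : ℝ)
    (hgraph : fderiv ℝ (fun x => eta3 (ν x) (μ x)) p e3 = 0)
    (htan : ∀ V : Fin 3 → ℝ, eta3 V V = 1 → eta3 V e3 = 0 → eta3 V (μ p) = 0 →
      |fderiv ℝ (fun x => eta3 (ν x) (μ x)) p V| ≤ Cα)
    -- (v): the mean curvature bound `|H| ≤ C_H v`, where `H = A(T,T) + A(μ⊤,μ⊤)/(1+α²)`
    (CH : ℝ)
    (hH : |eta3 (fderiv ℝ ν p T) T + eta3 (fderiv ℝ ν p μtop) μtop / (1 + α ^ 2)|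
      ≤ CH * v)
    -- (vi): the gradient function is large at `p`
    (hbig : v > 2 * Real.sqrt (1 + α ^ 2)) :
    fderiv ℝ (fun x => -eta3 (ν x) e3) p μtop ≤
      (v ^ 2 / (1 + α ^ 2)) *
        ((1 + α ^ 2) * (|α| * CH + (2 * α ^ 2 + 1) * Cα + κ) - v * κ) ∧
    (κ⁻¹ * (1 + α ^ 2) * (|α| * CH + (2 * α ^ 2 + 1) * Cα + κ) ≤ v →
      fderiv ℝ (fun x => -eta3 (ν x) e3) p μtop ≤ 0) := by
  have hνd : DifferentiableAt ℝ ν p :=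
    (hν.differentiableOn one_ne_zero).differentiableAt (hU.mem_nhds hp)
  have hμd : DifferentiableAt ℝ μ p :=
    (hμ.differentiableOn one_ne_zero).differentiableAt (hU.mem_nhds hp)
  have hNν (X : Fin 3 → ℝ) : eta3 (fderiv ℝ ν p X) (ν p) = 0 := by
    have h := fderiv_eta3 hνd hνd X
    have hc : (fun x => eta3 (ν x) (ν x)) =ᶠ[nhds p] fun _ => (-1 : ℝ) :=
      Filter.eventually_of_mem (hU.mem_nhds hp) hνunit
    rw [hc.fderiv_eq, eta3_comm (ν p)] at h
    simp at h
    linarith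
  have hDv (X : Fin 3 → ℝ) :
      fderiv ℝ (fun x => -eta3 (ν x) e3) p X = -eta3 (fderiv ℝ ν p X) e3 := by
    have h := fderiv_eta3 hνd (differentiableAt_const (c := e3)) X
    rw [fderiv_fun_neg, neg_apply, h]
    simp [eta3]
  have hDα := fderiv_eta3 hνd hμd
  have hμ1 := hμunit p hp
  have hμ0 := hμe p hp
  have hν1 := hνunit p hp
  simp only [hDv] at hcrit ⊢
  simp only [hDα, hDμ] at hgraph htan
  clear hDv hDα hDμ
  generalize hN : fderiv ℝ ν p = N at *
  generalize ν p = n at *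
  generalize μ p = w at *
  have hw2 : w 2 = 0 := by simpa [eta3, e3] using hμ0
  have hw : w 0 ^ 2 + w 1 ^ 2 = 1 := by simp only [eta3, hw2] at hμ1; linarith
  have hn2 : v = n 2 := by simp [hv, eta3, e3]
  obtain ⟨V, hV⟩ : ∃ V : Fin 3 → ℝ, V = ![-w 1, w 0, 0] := ⟨_, rfl⟩
  obtain ⟨β, hβ⟩ : ∃ β, β = eta3 n V := ⟨_, rfl⟩
  have hnexp : n = α • w + β • V + v • e3 := by
    ext i
    simp only [Pi.add_apply, Pi.smul_apply, smul_eq_mul]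
    fin_cases i <;> simp [hα, hβ, hV, hn2, eta3, e3, hw2]
    · linear_combination -(n 0) * hw
    · linear_combination -(n 1) * hw
  have hVV : eta3 V V = 1 := by simp [hV, eta3]; linarith
  have hVe : eta3 V e3 = 0 := by simp [hV, eta3, e3]
  have hVw : eta3 V w = 0 := by simp [hV, eta3]; ring
  have hee : eta3 e3 e3 = -1 := by simp [eta3, e3]
  have hwn : eta3 w n = α := by rw [eta3_comm, hα]
  have hen : eta3 e3 n = -v := by rw [eta3_comm, hv]; ring
  have hVn : eta3 V n = β := by rw [eta3_comm, hβ]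
  have hnorm : β ^ 2 = v ^ 2 - 1 - α ^ 2 := by
    have h := hν1
    nth_rw 1 [hnexp] at h
    simp only [eta3_add_left, eta3_smul_left, hwn, hen, hVn] at h
    linarith
  have hapos : 0 < 1 + α ^ 2 := by positivity
  have hs := Real.sq_sqrt hapos.le
  have hspos := Real.sqrt_pos.2 hapos
  have hvpos : 0 < v := by linarith
  have hbig' : 4 * (1 + α ^ 2) < v ^ 2 := by nlinarith
  have hβ2 : 0 < β ^ 2 := by linarith
  have hβ0 : β ≠ 0 := by rintro rfl; simp at hβ2
  obtain ⟨S, hS⟩ : ∃ S : Fin 3 → ℝ, S = β • e3 + v • V := ⟨_, rfl⟩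
  have heτS : eτ = (-(β / (1 + α ^ 2))) • S := by
    have h : νSig = β • V + v • e3 := by
      rw [hνSig, hnexp]; module
    have h' : (1 : ℝ) = (v ^ 2 - β ^ 2) / (1 + α ^ 2) := by field_simp; linarith
    calc eτ = ((v ^ 2 - β ^ 2) / (1 + α ^ 2)) • e3 - (v / (1 + α ^ 2)) • (β • V + v • e3) := by
          rw [heτ, h, ← h', one_smul]
      _ = _ := by rw [hS]; module
  have hSe : eta3 (N S) e3 = 0 := by
    rw [heτS, map_smul, eta3_smul_left] at hcrit
    have : β / (1 + α ^ 2) ≠ 0 := by positivity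
    simpa [this, hβ0, hapos.ne'] using hcrit
  have hSn : eta3 S n = 0 := by
    simp only [hS, eta3_add_left, eta3_smul_left, hen, hVn]; ring
  have htopn : eta3 μtop n = 0 := by
    simp only [hμtop, eta3_add_left, eta3_smul_left, hν1, hwn]; ring
  have hexp (X : Fin 3 → ℝ) :
      α * eta3 (N X) w + β * eta3 (N X) V + v * eta3 (N X) e3 = 0 := by
    have h := hNν X
    rw [hnexp] at h
    simpa only [eta3_add_right, eta3_smul_right] using h
  have hNe : eta3 (N e3) w = 0 := by
    have h0 : e3 - eta3 e3 w • w + eta3 e3 e3 • e3 = 0 := by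
      rw [hee, eta3_comm, hμ0]; module
    rw [h0, smul_zero] at hgraph
    simpa [eta3] using hgraph
  have hδ := htan V hVV hVe hVw
  have h0 : V - eta3 V w • w + eta3 V e3 • e3 = V := by rw [hVw, hVe]; module
  rw [h0, eta3_smul_right, ← hβ] at hδ
  obtain ⟨δ, hδe⟩ : ∃ δ, δ = eta3 (N V) w + κ * β := ⟨_, rfl⟩
  rw [← hδe] at hδ
  have hNSw : eta3 (N S) w = v * (δ - κ * β) := by
    rw [hS, map_add, map_smul, map_smul, eta3_add_left, eta3_smul_left, eta3_smul_left, hNe, hδe]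
    ring
  have htopw (X : Fin 3 → ℝ) : eta3 (N X) μtop = eta3 (N X) w := by
    rw [hμtop, eta3_add_right, eta3_smul_right, hNν]; ring
  have hNtopS : eta3 (N μtop) S = β * eta3 (N μtop) e3 + v * eta3 (N μtop) V := by
    rw [hS, eta3_add_right, eta3_smul_right, eta3_smul_right]
  have hsymm : β * eta3 (N μtop) e3 + v * eta3 (N μtop) V = v * (δ - κ * β) := by
    rw [← hNtopS, ← hsymν S μtop hSn htopn, htopw, hNSw]
  have hNSS : eta3 (N S) S = -(α * v ^ 2 * (δ - κ * β) / β) := by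
    have h := hexp S
    rw [hNSw, hSe] at h
    have h' : eta3 (N S) S = v * eta3 (N S) V := by
      rw [hS, eta3_add_right, eta3_smul_right, eta3_smul_right, ← hS, hSe]; ring
    rw [h']
    field_simp
    linear_combination h
  have hTT : eta3 (N T) T = eta3 (N S) S / (1 + α ^ 2) := by
    have hb : Real.sqrt (v ^ 2 - 1 - α ^ 2) ^ 2 = β ^ 2 := by
      rw [Real.sq_sqrt (by linarith), hnorm]
    rw [hT, heτS]
    simp only [map_smul, eta3_smul_left, eta3_smul_right]
    calc _ = Real.sqrt (1 + α ^ 2) ^ 2 / Real.sqrt (v ^ 2 - 1 - α ^ 2) ^ 2 *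
          (β / (1 + α ^ 2)) ^ 2 * eta3 (N S) S := by ring
      _ = _ := by rw [hs, hb]; field_simp
  rw [hTT, htopw, hNSS] at hH
  have hkey := conormal_derivative_eq
    (H := -(α * v ^ 2 * (δ - κ * β) / β) / (1 + α ^ 2) + eta3 (N μtop) w / (1 + α ^ 2))
    hβ0 hnorm (hexp μtop) hsymm (by field_simp; ring)
  have hmain := hkey.le.trans (conormal_derivative_le hκ hβ0 hnorm hvpos hbig' hδ hH)
  refine ⟨hmain, fun h => hmain.trans (mul_nonpos_of_nonneg_of_nonpos (by positivity) ?_)⟩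
  rw [mul_assoc, inv_mul_le_iff₀ hκ] at h
  linarith
end
end
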